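/- arXiv:2403.12424 — 2 statements merged into one kernel-verified Lean document; each statement's English description precedes it below -/
import Mathlib

section
/- Let z, z′, z″ be nonzero complex numbers satisfying z·z′·z″ = i (where i is the imaginary unit) and z² + (z′)⁻² = 1. Then (z′)² + (z″)⁻² = 1 and (z″)² + z⁻² = 1. -/
/-- For nonzero complex square-root shape parameters with `z z' z'' = i` and
`z² + (z')⁻² = 1`, the other two Lagrangian equations follow. -/
theorem shape_lagrangian_equations
    (z z' z'' : ℂ) (hz : z ≠ 0) (hz' : z' ≠ 0) (hz'' : z'' ≠ 0)
    (hprod : z * z' * z'' = Complex.I)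
    (hlag : z ^ 2 + (z' ^ 2)⁻¹ = 1) :
    z' ^ 2 + (z'' ^ 2)⁻¹ = 1 ∧ z'' ^ 2 + (z ^ 2)⁻¹ = 1 := by
  have hsq : z ^ 2 * z' ^ 2 * z'' ^ 2 = -1 := by
    rw [← mul_pow, ← mul_pow, hprod, Complex.I_sq]
  have hb : z ^ 2 * z' ^ 2 + 1 = z' ^ 2 := by
    field_simp at hlag
    linear_combination hlag
  constructor
  · field_simp
    linear_combination hsq - z'' ^ 2 * hb
  · field_simp
    refine mul_left_cancel₀ (pow_ne_zero 2 hz') ?_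
    linear_combination hsq - hb
end

section
/- Let z₁, z₂, z₃ be nonzero complex numbers satisfying z₁z₂z₃ = i, z₁² + z₂⁻² = 1, z₂² + z₃⁻² = 1, and z₃² + z₁⁻² = 1, and let B = [[i,0],[1,−i]]. Then the product of complex 2×2 matrices ([[z₁,0],[0,z₁⁻¹]]·B) · ([[z₂,0],[0,z₂⁻¹]]·B) · ([[z₃,0],[0,z₃⁻¹]]·B) equals the identity matrix. -/
/-- The vertex hexagon word `(γ⁻¹β)³` evaluates to the identity when the three short
edges carry the square-root shape parameters of a tetrahedron. -/
theorem vertex_hexagon_word_is_identity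
    (z₁ z₂ z₃ : ℂ) (h₁ : z₁ ≠ 0) (h₂ : z₂ ≠ 0) (h₃ : z₃ ≠ 0)
    (hprod : z₁ * z₂ * z₃ = Complex.I)
    (l₁ : z₁ ^ 2 + (z₂ ^ 2)⁻¹ = 1)
    (l₂ : z₂ ^ 2 + (z₃ ^ 2)⁻¹ = 1)
    (l₃ : z₃ ^ 2 + (z₁ ^ 2)⁻¹ = 1) :
    let B : Matrix (Fin 2) (Fin 2) ℂ := !![Complex.I, 0; 1, -Complex.I]
    (!![z₁, 0; 0, z₁⁻¹] * B) * (!![z₂, 0; 0, z₂⁻¹] * B) * (!![z₃, 0; 0, z₃⁻¹] * B) = 1 := by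
  intro B
  have hI : Complex.I ^ 2 = -1 := Complex.I_sq
  have l₂' : z₂ ^ 2 * z₃ ^ 2 + 1 = z₃ ^ 2 := by
    field_simp at l₂
    linear_combination l₂
  have diag_mul (z : ℂ) :
      !![z, 0; 0, z⁻¹] * B = !![z * Complex.I, 0; z⁻¹, -(z⁻¹ * Complex.I)] := by
    simp [B]
  have hinv : z₁⁻¹ * z₂⁻¹ * z₃⁻¹ = -Complex.I := by
    rw [← mul_inv, ← mul_inv, hprod, Complex.inv_I]
  rw [diag_mul, diag_mul, diag_mul, Matrix.mul_fin_two, Matrix.mul_fin_two, Matrix.one_fin_two]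
  congr!
  · linear_combination Complex.I ^ 3 * hprod + (Complex.I ^ 2 - 1) * hI
  · ring
  · field_simp
    linear_combination (z₂ ^ 2 * z₃ ^ 2 - z₃ ^ 2 + 1) * hI - l₂'
  · linear_combination -Complex.I ^ 3 * hinv + (Complex.I ^ 2 - 1) * hI
end
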